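/- arXiv:2210.13384 — 3 statements merged into one kernel-verified Lean document; each statement's English description precedes it below -/
import Mathlib

section
/- Let λ ∈ (0,1) and set ρ = √(1−λ²)/λ, so that the two families of chess-billiard lines have slopes ±ρ. Let b_λ : ∂Ω → ∂Ω be the chess billiard map on the boundary of the square Ω = [0,1/4]², where for p ∈ ∂Ω one first travels along the line of slope ρ through p to its second intersection point p' with ∂Ω (with the convention p' = p if that line meets the closed square only at p), and then travels along the line of slope −ρ through p' to its second intersection point with ∂Ω (same convention), which is b_λ(p). Parameterize ∂Ω by arc length via a map from ℝ/ℤ (the perimeter equals 1), oriented counterclockwise. Then b_λ is an orientation-preserving circle map admitting a monotone degree-one lift F : ℝ → ℝ (so F(x+1) = F(x)+1), and the translation (rotation) number of F equals λ/(√(1−λ²)+λ). -/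
open Real

/-- The square `Ω = [0,1/4]²`. -/
def chessSquare : Set (ℝ × ℝ) :=
  Set.Icc (0 : ℝ) (1 / 4) ×ˢ Set.Icc (0 : ℝ) (1 / 4)

/-- The boundary `∂Ω` of the square. -/
def chessBdry : Set (ℝ × ℝ) := frontier chessSquare

/-- `q` lies on the line through `p` of slope `σ`. -/
def onLine (σ : ℝ) (p q : ℝ × ℝ) : Prop :=
  q.2 - p.2 = σ * (q.1 - p.1)

/-- `q` is "the second intersection point" of the line of slope `σ` through `p ∈ ∂Ω`
with `∂Ω`: it lies on `∂Ω` and on the line, and it may equal `p` only when the line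
meets the closed square only at `p`. -/
def secondPoint (σ : ℝ) (p q : ℝ × ℝ) : Prop :=
  q ∈ chessBdry ∧ onLine σ p q ∧
    (q = p → ∀ z ∈ chessSquare, onLine σ p z → z = p)

/-- `q = b_λ(p)` for the chess billiard map with slopes `±σ`:
first travel along the line of slope `σ` from `p` to its second intersection `p'`
with `∂Ω`, then along the line of slope `−σ` from `p'` to its second intersection `q`. -/
def chessRel (σ : ℝ) (p q : ℝ × ℝ) : Prop :=
  ∃ p' : ℝ × ℝ, secondPoint σ p p' ∧ secondPoint (-σ) p' q

/-- Counterclockwise arc-length parameterization `ℝ/ℤ → ∂Ω` of the boundary of the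
square `[0,1/4]²` (the perimeter equals `1`), given as a `1`-periodic map on `ℝ`. -/
noncomputable def bdryParam (s : ℝ) : ℝ × ℝ :=
  let u := Int.fract s
  if u ≤ 1 / 4 then (u, 0)
  else if u ≤ 1 / 2 then (1 / 4, u - 1 / 4)
  else if u ≤ 3 / 4 then (3 / 4 - u, 1 / 4)
  else (0, 1 - u)

theorem mem_chessBdry_iff (p : ℝ × ℝ) :
    p ∈ chessBdry ↔ (0 ≤ p.1 ∧ p.1 ≤ 1 / 4) ∧ (0 ≤ p.2 ∧ p.2 ≤ 1 / 4) ∧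
      (p.1 = 0 ∨ p.1 = 1 / 4 ∨ p.2 = 0 ∨ p.2 = 1 / 4) := by
  have h : (0 : ℝ) ≤ 1 / 4 := by norm_num
  rw [chessBdry, chessSquare, frontier_prod_eq, closure_Icc, frontier_Icc h]
  simp only [Set.mem_union, Set.mem_prod, Set.mem_Icc, Set.mem_insert_iff,
    Set.mem_singleton_iff]
  constructor
  · rintro (⟨⟨h1, h2⟩, h3 | h3⟩ | ⟨h3 | h3, h1, h2⟩) <;> simp_all
  · rintro ⟨h1, h2, h3 | h3 | h3 | h3⟩ <;> simp_all

theorem bdryParam_mem_chessBdry (x : ℝ) : bdryParam x ∈ chessBdry := by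
  have h0 := Int.fract_nonneg x
  have h1 := Int.fract_lt_one x
  rw [mem_chessBdry_iff]
  simp only [bdryParam]
  split_ifs <;> simp only [true_or, or_true, and_true] <;>
    refine ⟨⟨?_, ?_⟩, ?_, ?_⟩ <;> linarith

theorem fract_eq_of_bdryParam_eq {x y : ℝ} (h : bdryParam x = bdryParam y) :
    Int.fract x = Int.fract y := by
  have hx0 := Int.fract_nonneg x
  have hx1 := Int.fract_lt_one x
  have hy0 := Int.fract_nonneg y
  have hy1 := Int.fract_lt_one y
  simp only [bdryParam] at h
  split_ifs at h <;> rw [Prod.mk.injEq] at h <;> obtain ⟨h1, h2⟩ := h <;> linarith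

theorem exists_bdryParam_eq {p : ℝ × ℝ} (hp : p ∈ chessBdry) : ∃ x, bdryParam x = p := by
  obtain ⟨a, b⟩ := p
  rw [mem_chessBdry_iff] at hp
  obtain ⟨⟨ha0, ha1⟩, ⟨hb0, hb1⟩, h⟩ := hp
  dsimp only at ha0 ha1 hb0 hb1 h
  have key : ∀ u : ℝ, 0 ≤ u → u < 1 → Int.fract u = u := fun u h0 h1 =>
    Int.fract_eq_self.2 ⟨h0, h1⟩
  rcases h with rfl | rfl | rfl | rfl
  · rcases hb0.eq_or_lt with rfl | hb
    · exact ⟨0, by norm_num [bdryParam]⟩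
    · refine ⟨1 - b, ?_⟩
      simp only [bdryParam, key (1 - b) (by linarith) (by linarith)]
      split_ifs <;> simp only [Prod.mk.injEq] <;> constructor <;> first | trivial | linarith
  · refine ⟨1 / 4 + b, ?_⟩
    simp only [bdryParam, key (1 / 4 + b) (by linarith) (by linarith)]
    split_ifs <;> simp only [Prod.mk.injEq] <;> constructor <;> first | trivial | linarith
  · refine ⟨a, ?_⟩
    simp only [bdryParam, key a (by linarith) (by linarith)]
    split_ifs <;> rfl
  · refine ⟨3 / 4 - a, ?_⟩
    simp only [bdryParam, key (3 / 4 - a) (by linarith) (by linarith)]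
    split_ifs <;> simp only [Prod.mk.injEq] <;> constructor <;> first | trivial | linarith

theorem AddCircle.norm_coe_eq_abs_sub {p x : ℝ} (n : ℤ) (hp : 0 < p)
    (h : |x - n * p| ≤ p / 2) : ‖(x : AddCircle p)‖ = |x - n * p| := by
  have hx : (x : AddCircle p) = ((x - n * p : ℝ) : AddCircle p) := by
    rw [eq_comm, ← sub_eq_zero, ← AddCircle.coe_sub, AddCircle.coe_eq_zero_iff]
    exact ⟨-n, by simp⟩
  rw [hx, AddCircle.norm_coe_eq_abs_iff _ hp.ne', abs_of_pos hp]
  exact h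

theorem UnitAddCircle.norm_eq_zero_or_half {w : UnitAddCircle} (h : w + w = 0) :
    ‖w‖ = 0 ∨ ‖w‖ = 1 / 2 := by
  induction w using QuotientAddGroup.induction_on with
  | H t =>
    obtain ⟨n, hn⟩ := (AddCircle.coe_eq_zero_iff (1 : ℝ) (x := t + t)).1 (by simpa using h)
    have hr := abs_sub_round t
    rw [UnitAddCircle.norm_eq]
    have ht : t - round t = ((n - 2 * round t : ℤ) : ℝ) / 2 := by
      push_cast
      rw [zsmul_eq_mul] at hn
      linarith
    rw [ht] at hr ⊢
    generalize n - 2 * round t = m at hr ⊢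
    rw [abs_le] at hr
    have h1 : -1 ≤ m := by exact_mod_cast (by linarith : (-1 : ℝ) ≤ m)
    have h2 : m ≤ 1 := by exact_mod_cast (by linarith : (m : ℝ) ≤ 1)
    interval_cases m <;> norm_num

/-- The piecewise linear coordinate on the boundary of the square, of slope `2 * a` on the
horizontal sides and `2 * (1 - a)` on the vertical ones, in which following a line of slope
`± a / (1 - a)` is a reflection. -/
noncomputable def chessCoord (a x : ℝ) : ℝ :=
  x + (2 * a - 1) * ‖(x : AddCircle (1 / 2 : ℝ))‖

theorem chessCoord_add_int (a x : ℝ) (n : ℤ) : chessCoord a (x + n) = chessCoord a x + n := by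
  have h : ((n : ℝ) : AddCircle (1 / 2 : ℝ)) = 0 :=
    (AddCircle.coe_eq_zero_iff _).2 ⟨2 * n, by rw [zsmul_eq_mul]; push_cast; ring⟩
  rw [chessCoord, AddCircle.coe_add, h, add_zero, chessCoord]
  ring

theorem coe_chessCoord_eq_of_fract_eq (a : ℝ) {x y : ℝ} (h : Int.fract x = Int.fract y) :
    (chessCoord a x : UnitAddCircle) = chessCoord a y := by
  obtain ⟨n, hn⟩ := Int.fract_eq_fract.1 h
  rw [← sub_eq_zero, ← AddCircle.coe_sub, AddCircle.coe_eq_zero_iff]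
  refine ⟨n, ?_⟩
  rw [show x = y + n by linarith, chessCoord_add_int]
  simp

theorem strictMono_chessCoord {a : ℝ} (h0 : 0 < a) (h1 : a < 1) :
    StrictMono (chessCoord a) := by
  intro x y hxy
  have h : |‖(x : AddCircle (1 / 2 : ℝ))‖ - ‖(y : AddCircle (1 / 2 : ℝ))‖| ≤ y - x := by
    refine (abs_norm_sub_norm_le _ _).trans ?_
    rw [← AddCircle.coe_sub, ← abs_of_pos (sub_pos.2 hxy), abs_sub_comm]
    exact QuotientAddGroup.norm_mk_le_norm
  rw [abs_le] at h
  simp only [chessCoord]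
  generalize ‖(x : AddCircle (1 / 2 : ℝ))‖ = u at h ⊢
  generalize ‖(y : AddCircle (1 / 2 : ℝ))‖ = v at h ⊢
  rcases le_total u v with huv | huv
  · nlinarith [mul_pos h0 (show 0 < y - x + (v - u) by linarith),
      mul_nonneg (sub_pos.2 h1).le (show 0 ≤ y - x - (v - u) by linarith)]
  · nlinarith [mul_pos (sub_pos.2 h1) (show 0 < y - x - (v - u) by linarith),
      mul_nonneg h0.le (show 0 ≤ y - x + (v - u) by linarith)]

theorem continuous_chessCoord (a : ℝ) : Continuous (chessCoord a) :=
  continuous_id.add (continuous_const.mul (AddCircle.continuous_mk' _).norm)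

theorem surjective_chessCoord (a : ℝ) : Function.Surjective (chessCoord a) := by
  have hz : chessCoord a 0 = 0 := by simp [chessCoord]
  have hn : ∀ n : ℤ, chessCoord a n = n := fun n => by
    simpa [hz] using chessCoord_add_int a 0 n
  intro t
  obtain ⟨x, -, hx⟩ := intermediate_value_Icc
    (show (⌊t⌋ : ℝ) ≤ ((⌊t⌋ + 1 : ℤ) : ℝ) by push_cast; linarith)
    (continuous_chessCoord a).continuousOn
    (show t ∈ Set.Icc (chessCoord a ⌊t⌋) (chessCoord a ((⌊t⌋ + 1 : ℤ) : ℝ)) by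
      rw [hn, hn]
      exact ⟨Int.floor_le t, by push_cast; exact (Int.lt_floor_add_one t).le⟩)
  exact ⟨x, hx⟩

theorem chessCoord_of_le_quarter (a : ℝ) {u : ℝ} (h0 : 0 ≤ u) (h1 : u ≤ 1 / 4) :
    chessCoord a u = 2 * a * u := by
  have h : |u - (0 : ℤ) * (1 / 2 : ℝ)| = u := by
    rw [abs_of_nonneg] <;> push_cast <;> linarith
  rw [chessCoord, AddCircle.norm_coe_eq_abs_sub 0 (by norm_num) (by linarith), h]
  ring

theorem chessCoord_of_le_half (a : ℝ) {u : ℝ} (h0 : 1 / 4 ≤ u) (h1 : u ≤ 1 / 2) :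
    chessCoord a u = a - 1 / 2 + 2 * (1 - a) * u := by
  have h : |u - (1 : ℤ) * (1 / 2 : ℝ)| = 1 / 2 - u := by
    rw [abs_of_nonpos] <;> push_cast <;> linarith
  rw [chessCoord, AddCircle.norm_coe_eq_abs_sub 1 (by norm_num) (by linarith), h]
  ring

theorem chessCoord_of_le_three_quarters (a : ℝ) {u : ℝ} (h0 : 1 / 2 ≤ u) (h1 : u ≤ 3 / 4) :
    chessCoord a u = 1 / 2 - a + 2 * a * u := by
  have h : |u - (1 : ℤ) * (1 / 2 : ℝ)| = u - 1 / 2 := by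
    rw [abs_of_nonneg] <;> push_cast <;> linarith
  rw [chessCoord, AddCircle.norm_coe_eq_abs_sub 1 (by norm_num) (by linarith), h]
  ring

theorem chessCoord_of_le_one (a : ℝ) {u : ℝ} (h0 : 3 / 4 ≤ u) (h1 : u ≤ 1) :
    chessCoord a u = 2 * a - 1 + 2 * (1 - a) * u := by
  have h : |u - (2 : ℤ) * (1 / 2 : ℝ)| = 1 - u := by
    rw [abs_of_nonpos] <;> push_cast <;> linarith
  rw [chessCoord, AddCircle.norm_coe_eq_abs_sub 2 (by norm_num) (by linarith), h]
  ring

theorem UnitAddCircle.norm_coe_of_abs_le {t : ℝ} (h0 : |t| ≤ 1 / 2) :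
    ‖(t : UnitAddCircle)‖ = |t| := by
  simpa using AddCircle.norm_coe_eq_abs_sub (p := 1) (x := t) 0 one_pos (by simpa using h0)

theorem UnitAddCircle.norm_coe_of_half_le {t : ℝ} (h0 : 1 / 2 ≤ t) (h1 : t ≤ 1) :
    ‖(t : UnitAddCircle)‖ = 1 - t := by
  have h : |t - (1 : ℤ) * (1 : ℝ)| = 1 - t := by
    rw [abs_of_nonpos] <;> push_cast <;> linarith
  rw [← h]
  exact AddCircle.norm_coe_eq_abs_sub 1 one_pos (by rw [h]; linarith)

theorem chess_sum_eq_norm {a : ℝ} (h0 : 0 < a) (h1 : a < 1) (x : ℝ) :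
    a * (bdryParam x).1 + (1 - a) * (bdryParam x).2 =
      ‖(chessCoord a x : UnitAddCircle)‖ / 2 := by
  have hx0 := Int.fract_nonneg x
  have hx1 := Int.fract_lt_one x
  rw [coe_chessCoord_eq_of_fract_eq a (Int.fract_fract x).symm]
  simp only [bdryParam]
  generalize Int.fract x = u at hx0 hx1 ⊢
  have h1' : 0 < 1 - a := by linarith
  split_ifs with h2 h3 h4
  · rw [chessCoord_of_le_quarter a hx0 h2]
    have hn : 0 ≤ 2 * a * u := by positivity
    rw [UnitAddCircle.norm_coe_of_abs_le] <;> rw [abs_of_nonneg hn]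
    · ring
    · nlinarith
  · push Not at h2
    rw [chessCoord_of_le_half a h2.le h3]
    have hn : 0 ≤ a - 1 / 2 + 2 * (1 - a) * u := by nlinarith
    rw [UnitAddCircle.norm_coe_of_abs_le] <;> rw [abs_of_nonneg hn]
    · ring
    · nlinarith
  · push Not at h3
    rw [chessCoord_of_le_three_quarters a h3.le h4,
      UnitAddCircle.norm_coe_of_half_le (by nlinarith) (by nlinarith)]
    ring
  · push Not at h4
    rw [chessCoord_of_le_one a h4.le hx1.le,
      UnitAddCircle.norm_coe_of_half_le (by nlinarith) (by nlinarith)]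
    ring

theorem chess_diff_eq_norm {a : ℝ} (h0 : 0 < a) (h1 : a < 1) (x : ℝ) :
    a * (bdryParam x).1 - (1 - a) * (bdryParam x).2 =
      a / 4 - ‖((chessCoord a x - a / 2 : ℝ) : UnitAddCircle)‖ / 2 := by
  have hx0 := Int.fract_nonneg x
  have hx1 := Int.fract_lt_one x
  rw [AddCircle.coe_sub, coe_chessCoord_eq_of_fract_eq a (Int.fract_fract x).symm,
    ← AddCircle.coe_sub]
  simp only [bdryParam]
  generalize Int.fract x = u at hx0 hx1 ⊢
  have h1' : 0 < 1 - a := by linarith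
  split_ifs with h2 h3 h4
  · rw [chessCoord_of_le_quarter a hx0 h2]
    have hn : 2 * a * u - a / 2 ≤ 0 := by nlinarith
    rw [UnitAddCircle.norm_coe_of_abs_le] <;> rw [abs_of_nonpos hn]
    · ring
    · nlinarith
  · push Not at h2
    rw [chessCoord_of_le_half a h2.le h3]
    have hn : 0 ≤ a - 1 / 2 + 2 * (1 - a) * u - a / 2 := by nlinarith
    rw [UnitAddCircle.norm_coe_of_abs_le] <;> rw [abs_of_nonneg hn]
    · ring
    · nlinarith
  · push Not at h3
    rw [chessCoord_of_le_three_quarters a h3.le h4]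
    have hn : 0 ≤ 1 / 2 - a + 2 * a * u - a / 2 := by nlinarith
    rw [UnitAddCircle.norm_coe_of_abs_le] <;> rw [abs_of_nonneg hn]
    · ring
    · nlinarith
  · push Not at h4
    rw [chessCoord_of_le_one a h4.le hx1.le,
      UnitAddCircle.norm_coe_of_half_le (by nlinarith) (by nlinarith)]
    ring

theorem onLine_pos_iff {a : ℝ} (h1 : a < 1) (p q : ℝ × ℝ) :
    onLine (a / (1 - a)) p q ↔ a * p.1 - (1 - a) * p.2 = a * q.1 - (1 - a) * q.2 := by
  have h : (1 - a) ≠ 0 := by linarith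
  rw [onLine, div_mul_eq_mul_div, eq_div_iff h]
  constructor <;> intro h <;> linarith

theorem onLine_neg_iff {a : ℝ} (h1 : a < 1) (p q : ℝ × ℝ) :
    onLine (-(a / (1 - a))) p q ↔ a * p.1 + (1 - a) * p.2 = a * q.1 + (1 - a) * q.2 := by
  have h : (1 - a) ≠ 0 := by linarith
  rw [onLine, ← neg_div, div_mul_eq_mul_div, eq_div_iff h]
  constructor <;> intro h <;> linarith

theorem eq_of_chess_sum_extremal {a : ℝ} (h0 : 0 < a) (h1 : a < 1) {p z : ℝ × ℝ}
    (hp : p ∈ chessSquare) (hz : z ∈ chessSquare)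
    (h : a * p.1 + (1 - a) * p.2 = a * z.1 + (1 - a) * z.2)
    (he : a * p.1 + (1 - a) * p.2 = 0 ∨ a * p.1 + (1 - a) * p.2 = 1 / 4) : z = p := by
  obtain ⟨⟨p1, p2⟩, p3, p4⟩ := hp
  obtain ⟨⟨z1, z2⟩, z3, z4⟩ := hz
  have h1' : 0 < 1 - a := by linarith
  rcases he with he | he <;> apply Prod.ext <;> apply le_antisymm <;> nlinarith

theorem eq_of_chess_diff_extremal {a : ℝ} (h0 : 0 < a) (h1 : a < 1) {p z : ℝ × ℝ}
    (hp : p ∈ chessSquare) (hz : z ∈ chessSquare)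
    (h : a * p.1 - (1 - a) * p.2 = a * z.1 - (1 - a) * z.2)
    (he : a * p.1 - (1 - a) * p.2 = a / 4 ∨ a * p.1 - (1 - a) * p.2 = (a - 1) / 4) :
    z = p := by
  obtain ⟨⟨p1, p2⟩, p3, p4⟩ := hp
  obtain ⟨⟨z1, z2⟩, z3, z4⟩ := hz
  have h1' : 0 < 1 - a := by linarith
  rcases he with he | he <;> apply Prod.ext <;> apply le_antisymm <;> nlinarith

theorem chessBdry_subset_chessSquare : chessBdry ⊆ chessSquare :=
  (isClosed_Icc.prod isClosed_Icc).frontier_subset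

theorem secondPoint_neg_of_add_eq_zero {a : ℝ} (h0 : 0 < a) (h1 : a < 1) {x y : ℝ}
    (h : (chessCoord a x : UnitAddCircle) + chessCoord a y = 0) :
    secondPoint (-(a / (1 - a))) (bdryParam x) (bdryParam y) := by
  refine ⟨bdryParam_mem_chessBdry y, ?_, ?_⟩
  · rw [onLine_neg_iff h1, chess_sum_eq_norm h0 h1, chess_sum_eq_norm h0 h1,
      eq_neg_of_add_eq_zero_left h, norm_neg]
  · intro hyx z hz hl
    rw [onLine_neg_iff h1] at hl
    refine eq_of_chess_sum_extremal h0 h1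
      (chessBdry_subset_chessSquare (bdryParam_mem_chessBdry x)) hz hl ?_
    rw [coe_chessCoord_eq_of_fract_eq a (fract_eq_of_bdryParam_eq hyx)] at h
    rw [chess_sum_eq_norm h0 h1]
    rcases UnitAddCircle.norm_eq_zero_or_half h with h | h <;> rw [h] <;> norm_num

theorem secondPoint_pos_of_add_eq {a : ℝ} (h0 : 0 < a) (h1 : a < 1) {x y : ℝ}
    (h : (chessCoord a x : UnitAddCircle) + chessCoord a y = a) :
    secondPoint (a / (1 - a)) (bdryParam x) (bdryParam y) := by
  have h' : ((chessCoord a x - a / 2 : ℝ) : UnitAddCircle) +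
      ((chessCoord a y - a / 2 : ℝ) : UnitAddCircle) = 0 := by
    rw [← AddCircle.coe_add] at h ⊢
    rw [show chessCoord a x - a / 2 + (chessCoord a y - a / 2) =
      chessCoord a x + chessCoord a y - a by ring, AddCircle.coe_sub, h, sub_self]
  refine ⟨bdryParam_mem_chessBdry y, ?_, ?_⟩
  · rw [onLine_pos_iff h1, chess_diff_eq_norm h0 h1, chess_diff_eq_norm h0 h1,
      eq_neg_of_add_eq_zero_left h', norm_neg]
  · intro hyx z hz hl
    rw [onLine_pos_iff h1] at hl
    refine eq_of_chess_diff_extremal h0 h1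
      (chessBdry_subset_chessSquare (bdryParam_mem_chessBdry x)) hz hl ?_
    rw [AddCircle.coe_sub, AddCircle.coe_sub,
      coe_chessCoord_eq_of_fract_eq a (fract_eq_of_bdryParam_eq hyx),
      ← AddCircle.coe_sub] at h'
    rw [chess_diff_eq_norm h0 h1]
    rcases UnitAddCircle.norm_eq_zero_or_half h' with h | h <;> rw [h]
    · left; ring
    · right; ring

theorem CircleDeg1Lift.map_fract_eq (F : CircleDeg1Lift) {x y : ℝ}
    (h : Int.fract x = Int.fract y) : Int.fract (F x) = Int.fract (F y) := by
  obtain ⟨n, hn⟩ := Int.fract_eq_fract.1 h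
  rw [show x = y + n by linarith, F.map_add_int, Int.fract_add_intCast]

theorem bdryParam_eq_of_fract_eq {x y : ℝ} (h : Int.fract x = Int.fract y) :
    bdryParam x = bdryParam y := by
  simp only [bdryParam, h]

theorem exists_chess_billiard_lift {a : ℝ} (h0 : 0 < a) (h1 : a < 1) :
    ∃ F : CircleDeg1Lift,
      (∀ x, chessRel (a / (1 - a)) (bdryParam x) (bdryParam (F x))) ∧
      F.translationNumber = 1 - a := by
  let e := (strictMono_chessCoord h0 h1).orderIsoOfSurjective _ (surjective_chessCoord a)
  have he : ∀ x, e x = chessCoord a x := fun _ => rfl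
  have hadd : ∀ x, e (x + 1) = e x + 1 := fun x => by
    simpa only [he, Int.cast_one] using chessCoord_add_int a x 1
  let F : CircleDeg1Lift :=
    ⟨⟨fun x => e.symm (e x + (1 - a)), fun x y h => by
      apply e.symm.monotone
      have := e.monotone h
      linarith⟩, fun x => by
      change e.symm (e (x + 1) + (1 - a)) = e.symm (e x + (1 - a)) + 1
      rw [e.symm_apply_eq, hadd, hadd, e.apply_symm_apply]
      ring⟩
  have hF : ∀ x, chessCoord a (F x) = chessCoord a x + (1 - a) := fun x =>
    e.apply_symm_apply _
  let H : CircleDeg1Lift := ⟨⟨chessCoord a, (strictMono_chessCoord h0 h1).monotone⟩, hadd⟩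
  refine ⟨F, fun x => ?_, ?_⟩
  · obtain ⟨y, hy⟩ := surjective_chessCoord a (a - chessCoord a x)
    refine ⟨bdryParam y, secondPoint_pos_of_add_eq h0 h1 ?_,
      secondPoint_neg_of_add_eq_zero h0 h1 ?_⟩
    · rw [hy, ← AddCircle.coe_add, add_sub_cancel]
    · rw [hy, hF, ← AddCircle.coe_add, AddCircle.coe_eq_zero_iff]
      exact ⟨1, by rw [one_zsmul]; ring⟩
  · have hs : Function.Semiconj H F
        (CircleDeg1Lift.translate (Multiplicative.ofAdd (1 - a)) : CircleDeg1Lift) := by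
      intro x
      rw [CircleDeg1Lift.translate_apply, add_comm]
      exact hF x
    rw [CircleDeg1Lift.translationNumber_eq_of_semiconj hs,
      CircleDeg1Lift.translationNumber_translate]

/-- For `λ ∈ (0,1)` and `ρ = √(1−λ²)/λ`, the chess billiard map `b_λ` on the boundary of
the square `[0,1/4]²` is an orientation-preserving circle map: it admits a monotone
degree-one lift `F : ℝ → ℝ` (through the arc-length parameterization of `∂Ω` by `ℝ/ℤ`),
and the translation (rotation) number of `F` equals `λ/(√(1−λ²)+λ)`. -/
theorem chess_billiard_rotation_number (l : ℝ) (hl : l ∈ Set.Ioo (0 : ℝ) 1) :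
    ∃ (b : ℝ × ℝ → ℝ × ℝ) (F : CircleDeg1Lift),
      (∀ p ∈ chessBdry, b p ∈ chessBdry ∧
        chessRel (Real.sqrt (1 - l ^ 2) / l) p (b p)) ∧
      (∀ x : ℝ, bdryParam (F x) = b (bdryParam x)) ∧
      F.translationNumber = l / (Real.sqrt (1 - l ^ 2) + l) := by
  obtain ⟨h0, h1⟩ := hl
  have hc : 0 < Real.sqrt (1 - l ^ 2) := Real.sqrt_pos.2 (by nlinarith)
  generalize Real.sqrt (1 - l ^ 2) = c at hc ⊢
  obtain ⟨F, hF, hτ⟩ := exists_chess_billiard_lift (a := c / (c + l)) (by positivity)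
    ((div_lt_one (by positivity)).2 (by linarith))
  have h2 : 1 - c / (c + l) = l / (c + l) := by field_simp; ring
  have h3 : c / (c + l) / (1 - c / (c + l)) = c / l := by rw [h2]; field_simp
  rw [h3] at hF
  rw [h2] at hτ
  refine ⟨fun p => bdryParam (F (Function.invFun bdryParam p)), F, fun p hp => ?_,
    fun x => ?_, hτ⟩
  · refine ⟨bdryParam_mem_chessBdry _, ?_⟩
    simpa only [Function.invFun_eq (exists_bdryParam_eq hp)] using
      hF (Function.invFun bdryParam p)
  · exact bdryParam_eq_of_fract_eq (F.map_fract_eq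
      (fract_eq_of_bdryParam_eq (Function.invFun_eq ⟨x, rfl⟩).symm))
end

section
/- Let λ ∈ (0,1), β > 0, and C > 0, and suppose the rotation number r(λ) = λ/(√(1−λ²)+λ) is irrational and satisfies |r(λ) − p/q| ≥ C/q^(2+β) for every p ∈ ℤ and every positive integer q. Then for all nonzero integers k₁, k₂ one has | |k₁|·λ − |k₂|·√(1−λ²) | ≥ C/(|k₁|+|k₂|)^(1+β). -/
open Real

/-- If the rotation number `r(λ) = λ/(√(1−λ²)+λ)` of the chess billiard flow in the
square is irrational and `β`-Diophantine with constant `C > 0`, then for all nonzero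
integers `k₁, k₂` one has `||k₁|·λ − |k₂|·√(1−λ²)| ≥ C/(|k₁|+|k₂|)^(1+β)`. -/
theorem diophantine_rotation_lower_bound (l β C : ℝ)
    (hl : l ∈ Set.Ioo (0 : ℝ) 1) (hβ : 0 < β) (hC : 0 < C)
    (hirr : Irrational (l / (Real.sqrt (1 - l ^ 2) + l)))
    (hdio : ∀ (p : ℤ) (q : ℤ), 0 < q →
      C / (q : ℝ) ^ ((2 : ℝ) + β) ≤
        |l / (Real.sqrt (1 - l ^ 2) + l) - (p : ℝ) / (q : ℝ)|) :
    ∀ k₁ k₂ : ℤ, k₁ ≠ 0 → k₂ ≠ 0 →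
      C / (|(k₁ : ℝ)| + |(k₂ : ℝ)|) ^ ((1 : ℝ) + β) ≤
        |(|(k₁ : ℝ)| * l - |(k₂ : ℝ)| * Real.sqrt (1 - l ^ 2))| := by
  intro k₁ k₂ hk₁ _
  obtain ⟨hl0, hl1⟩ := hl
  have hs0 : 0 ≤ √(1 - l ^ 2) := Real.sqrt_nonneg _
  have hs2 : √(1 - l ^ 2) ^ 2 = 1 - l ^ 2 := Real.sq_sqrt (by nlinarith)
  have h := hdio |k₂| (|k₁| + |k₂|) (by positivity)
  push_cast at h
  set s := √(1 - l ^ 2)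
  have ha : 0 < |(k₁ : ℝ)| := by positivity
  have hb : 0 ≤ |(k₂ : ℝ)| := abs_nonneg _
  generalize |(k₁ : ℝ)| = a at *
  generalize |(k₂ : ℝ)| = b at *
  have hq : 0 < a + b := by positivity
  have hsl : 1 ≤ s + l := by nlinarith [mul_nonneg hs0 hl0.le]
  have hsl0 : 0 < s + l := by positivity
  have key : a * l - b * s = (s + l) * ((a + b) * (l / (s + l) - b / (a + b))) := by
    field_simp
    ring
  have hpow : (a + b) ^ ((2 : ℝ) + β) = (a + b) ^ ((1 : ℝ) + β) * (a + b) := by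
    rw [← Real.rpow_add_one hq.ne']
    ring_nf
  calc C / (a + b) ^ ((1 : ℝ) + β) = (a + b) * (C / (a + b) ^ ((2 : ℝ) + β)) := by
        rw [hpow]
        field_simp
    _ ≤ (a + b) * |l / (s + l) - b / (a + b)| := by gcongr
    _ ≤ (s + l) * ((a + b) * |l / (s + l) - b / (a + b)|) :=
        le_mul_of_one_le_left (by positivity) hsl
    _ = |a * l - b * s| := by
        rw [key, abs_mul, abs_mul, abs_of_pos hsl0, abs_of_pos hq]
end

section
/- Let λ ∈ (0,1) and β > 0, and suppose the rotation number r(λ) = λ/(√(1−λ²)+λ) is irrational and β-Diophantine with some constant C > 0. Then there exists a constant C' > 0, independent of k₁ and k₂, such that for all nonzero integers k₁, k₂ the quantity k₁²λ² + k₂²λ² − k₂² is nonzero and |1/(k₁²λ² + k₂²λ² − k₂²)| ≤ C'·(√(1+k₁²+k₂²))^(1+β). -/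
/-- A Diophantine lower bound for `l / (s + l)` bounds the quadratic form `a² l² - b² s²` from
below at positive integers `a`, `b`. -/
lemma diophantine_lower_bound_sq_sub_sq {l s β C : ℝ} (hl : 0 < l) (hs : 0 < s) (hC : 0 < C)
    (hdio : ∀ p q : ℤ, 0 < q →
      C / (q : ℝ) ^ ((2 : ℝ) + β) ≤ |l / (s + l) - (p : ℝ) / (q : ℝ)|)
    {a b : ℤ} (ha : 0 < a) (hb : 0 < b) :
    C * (s + l) ^ 2 / ((a : ℝ) + b) ^ ((1 : ℝ) + β) ≤
      |(a : ℝ) ^ 2 * l ^ 2 - (b : ℝ) ^ 2 * s ^ 2| := by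
  have ha' : (1 : ℝ) ≤ a := by exact_mod_cast ha
  have hb' : (1 : ℝ) ≤ b := by exact_mod_cast hb
  have hq : (0 : ℝ) < a + b := by linarith
  have hsl : 0 < s + l := by linarith
  have h := hdio b (a + b) (by lia)
  push_cast at h
  have hdiff : l / (s + l) - (b : ℝ) / (a + b) = (a * l - b * s) / ((s + l) * (a + b)) := by
    field_simp
    ring
  have hpow : ((a : ℝ) + b) ^ ((2 : ℝ) + β) = (a + b) * ((a : ℝ) + b) ^ ((1 : ℝ) + β) := by
    rw [show (2 : ℝ) + β = 1 + (1 + β) by ring, Real.rpow_add hq 1, Real.rpow_one]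
  have hP : 0 < ((a : ℝ) + b) ^ ((1 : ℝ) + β) := Real.rpow_pos_of_pos hq _
  rw [hdiff, abs_div, abs_of_pos (mul_pos hsl hq), hpow, le_div_iff₀ (mul_pos hsl hq)] at h
  have hminus : C * (s + l) / ((a : ℝ) + b) ^ ((1 : ℝ) + β) ≤ |a * l - b * s| := by
    refine le_trans (le_of_eq ?_) h
    field_simp
  have hplus : s + l ≤ |a * l + b * s| := by
    refine le_trans ?_ (le_abs_self _)
    nlinarith
  calc C * (s + l) ^ 2 / ((a : ℝ) + b) ^ ((1 : ℝ) + β)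
      = C * (s + l) / ((a : ℝ) + b) ^ ((1 : ℝ) + β) * (s + l) := by ring
    _ ≤ |a * l - b * s| * |a * l + b * s| :=
        mul_le_mul hminus hplus hsl.le (abs_nonneg _)
    _ = |(a : ℝ) ^ 2 * l ^ 2 - (b : ℝ) ^ 2 * s ^ 2| := by
        rw [← abs_mul]
        ring_nf


/-- If the rotation number `r(λ) = λ/(√(1−λ²)+λ)` is irrational and `β`-Diophantine
with some constant `C > 0`, then there is `C' > 0` such that for all nonzero integers
`k₁, k₂`, the quantity `k₁²λ² + k₂²λ² − k₂²` is nonzero and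
`|1/(k₁²λ² + k₂²λ² − k₂²)| ≤ C'·(√(1+k₁²+k₂²))^(1+β)`. -/
theorem inverse_denominator_bound (l β C : ℝ)
    (hl : l ∈ Set.Ioo (0 : ℝ) 1) (hβ : 0 < β) (hC : 0 < C)
    (hirr : Irrational (l / (Real.sqrt (1 - l ^ 2) + l)))
    (hdio : ∀ (p : ℤ) (q : ℤ), 0 < q →
      C / (q : ℝ) ^ ((2 : ℝ) + β) ≤
        |l / (Real.sqrt (1 - l ^ 2) + l) - (p : ℝ) / (q : ℝ)|) :
    ∃ C' > (0 : ℝ), ∀ k₁ k₂ : ℤ, k₁ ≠ 0 → k₂ ≠ 0 →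
      (k₁ : ℝ) ^ 2 * l ^ 2 + (k₂ : ℝ) ^ 2 * l ^ 2 - (k₂ : ℝ) ^ 2 ≠ 0 ∧
      |1 / ((k₁ : ℝ) ^ 2 * l ^ 2 + (k₂ : ℝ) ^ 2 * l ^ 2 - (k₂ : ℝ) ^ 2)| ≤
        C' * Real.sqrt (1 + (k₁ : ℝ) ^ 2 + (k₂ : ℝ) ^ 2) ^ ((1 : ℝ) + β) := by
  obtain ⟨hl0, hl1⟩ := hl
  have hs2 : 0 < 1 - l ^ 2 := by nlinarith
  set s := Real.sqrt (1 - l ^ 2)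
  have hs : 0 < s := Real.sqrt_pos.mpr hs2
  have hsq : s ^ 2 = 1 - l ^ 2 := Real.sq_sqrt hs2.le
  refine ⟨(2 : ℝ) ^ ((1 : ℝ) + β) / (C * (s + l) ^ 2), by positivity, fun k₁ k₂ h₁ h₂ => ?_⟩
  have hbound := diophantine_lower_bound_sq_sub_sq hl0 hs hC hdio
    (abs_pos.mpr h₁) (abs_pos.mpr h₂)
  push_cast at hbound
  rw [sq_abs, sq_abs, hsq, show (k₁ : ℝ) ^ 2 * l ^ 2 - (k₂ : ℝ) ^ 2 * (1 - l ^ 2) =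
    (k₁ : ℝ) ^ 2 * l ^ 2 + (k₂ : ℝ) ^ 2 * l ^ 2 - (k₂ : ℝ) ^ 2 by ring] at hbound
  have hq : 0 < |(k₁ : ℝ)| + |(k₂ : ℝ)| :=
    add_pos (abs_pos.mpr (by exact_mod_cast h₁)) (abs_pos.mpr (by exact_mod_cast h₂))
  have hlow : 0 < C * (s + l) ^ 2 / (|(k₁ : ℝ)| + |(k₂ : ℝ)|) ^ ((1 : ℝ) + β) := by positivity
  refine ⟨abs_pos.mp (hlow.trans_le hbound), ?_⟩
  have hnorm : |(k₁ : ℝ)| + |(k₂ : ℝ)| ≤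
      2 * Real.sqrt (1 + (k₁ : ℝ) ^ 2 + (k₂ : ℝ) ^ 2) := by
    refine (abs_le_of_sq_le_sq' ?_ (by positivity)).2
    rw [mul_pow, Real.sq_sqrt (by positivity)]
    nlinarith [sq_abs (k₁ : ℝ), sq_abs (k₂ : ℝ), sq_nonneg (|(k₁ : ℝ)| - |(k₂ : ℝ)|)]
  rw [abs_div, abs_one]
  calc 1 / |(k₁ : ℝ) ^ 2 * l ^ 2 + (k₂ : ℝ) ^ 2 * l ^ 2 - (k₂ : ℝ) ^ 2|
      ≤ 1 / (C * (s + l) ^ 2 / (|(k₁ : ℝ)| + |(k₂ : ℝ)|) ^ ((1 : ℝ) + β)) :=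
        one_div_le_one_div_of_le hlow hbound
    _ = (|(k₁ : ℝ)| + |(k₂ : ℝ)|) ^ ((1 : ℝ) + β) / (C * (s + l) ^ 2) := one_div_div _ _
    _ ≤ (2 * Real.sqrt (1 + (k₁ : ℝ) ^ 2 + (k₂ : ℝ) ^ 2)) ^ ((1 : ℝ) + β) /
          (C * (s + l) ^ 2) := by gcongr
    _ = _ := by
        rw [Real.mul_rpow (by norm_num) (Real.sqrt_nonneg _)]
        ring
end
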